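/- arXiv:2105.07765 — 2 statements merged into one kernel-verified Lean document; each statement's English description precedes it below -/
import Mathlib

section
/- Let s ∈ ℝ^n with s ≠ 0, and let u ∈ ℝ^n be an eigenvector of H associated with the smallest eigenvalue λ_min[H], with ‖u‖₂ = 1 and N(u) ≤ 1, whose sign is chosen so that ⟨g + Hs, u⟩ ≤ 0. Assume λ_min[H] + σ N(s) < 0. Then there exists α > 0 such that m(s) − m(s + α N(s) u) ≥ (3(λ_min[H] + σ N(s))/(4σ²)) · [ ψ(s) σ² N(s)² − (3/4)(λ_min[H] + σ N(s))² ], where ψ(s) := max[0, 1 + 2⟨g + Hs, u⟩/(σ N(s)²)]. -/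
open scoped RealInnerProductSpace

noncomputable section

/-- Abbreviation for the Euclidean space `ℝ^n`. -/
abbrev E (n : ℕ) := EuclideanSpace ℝ (Fin n)

/-- `N` is a norm on `ℝ^n` (possibly non-smooth, e.g. `ℓ¹` or `ℓ∞`). -/
structure IsNorm (n : ℕ) (N : E n → ℝ) : Prop where
  add_le : ∀ x y, N (x + y) ≤ N x + N y
  smul : ∀ (c : ℝ) (x : E n), N (c • x) = |c| * N x
  eq_zero : ∀ x, N x = 0 → x = 0

/-- The dual norm `‖v‖_{N,1} := max_{N s = 1} ⟪v, s⟫`. -/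
def dualNorm (n : ℕ) (N : E n → ℝ) (v : E n) : ℝ :=
  sSup {t : ℝ | ∃ s, N s = 1 ∧ t = ⟪v, s⟫}

/-- The smallest eigenvalue of a symmetric operator `A`, as the infimum of the
Rayleigh quotient over the Euclidean unit sphere. -/
def lamMin (n : ℕ) (A : E n →L[ℝ] E n) : ℝ :=
  sInf {t : ℝ | ∃ v : E n, ‖v‖ = 1 ∧ t = ⟪A v, v⟫}

/-- The norm `‖H‖_{N,2} := max_{N s = 1} |⟪H s, s⟫|` of a symmetric operator induced by `N`. -/
def matNormN (n : ℕ) (N : E n → ℝ) (A : E n →L[ℝ] E n) : ℝ :=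
  sSup {t : ℝ | ∃ v : E n, N v = 1 ∧ t = |⟪A v, v⟫|}

/-- The regularized quadratic model
`m(s) = f₀ + ⟪g,s⟫ + (1/2)⟪Hs,s⟫ + (σ/6) N(s)³`. -/
def qm (n : ℕ) (N : E n → ℝ) (f0 : ℝ) (g : E n) (H : E n →L[ℝ] E n) (σ : ℝ)
    (s : E n) : ℝ :=
  f0 + ⟪g, s⟫ + (1 / 2) * ⟪H s, s⟫ + σ / 6 * N s ^ 3

/-- A function satisfying the norm axioms is nonnegative. -/
theorem IsNorm.nonneg {n : ℕ} {N : E n → ℝ} (hN : IsNorm n N) (x : E n) : 0 ≤ N x := by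
  have h0 : N 0 = 0 := by simpa using hN.smul 0 0
  have hneg : N (-x) = N x := by simpa using hN.smul (-1) x
  have h := hN.add_le x (-x)
  rw [add_neg_cancel, h0, hneg] at h
  linarith

/-- Decrease of the cubic model along a vector `u` with `N u ≤ 1` that is a unit eigenvector
of the symmetric operator `H`. -/
theorem qm_sub_qm_add_smul_ge {n : ℕ} {N : E n → ℝ} (hN : IsNorm n N)
    (f0 : ℝ) (g : E n) {H : E n →L[ℝ] E n} (hH : ∀ x y : E n, ⟪H x, y⟫ = ⟪x, H y⟫)
    {σ : ℝ} (hσ : 0 ≤ σ) (s : E n) {u : E n} {l : ℝ} (hu : H u = l • u) (hu2 : ‖u‖ = 1)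
    (huN : N u ≤ 1) {t : ℝ} (ht : 0 ≤ t) :
    -(t * (⟪g + H s, u⟫ + σ * N s ^ 2 / 2)) - t ^ 2 * (l + σ * N s) / 2 - σ * t ^ 3 / 6 ≤
      qm n N f0 g H σ s - qm n N f0 g H σ (s + t • u) := by
  have hquad : ⟪H (s + t • u), s + t • u⟫ = ⟪H s, s⟫ + 2 * t * ⟪H s, u⟫ + t ^ 2 * l := by
    have huu : ⟪u, u⟫ = 1 := by rw [real_inner_self_eq_norm_sq, hu2, one_pow]
    have hus : ⟪H u, s⟫ = ⟪H s, u⟫ := by rw [hH u s, real_inner_comm]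
    have hHuu : ⟪H u, u⟫ = l := by rw [hu, real_inner_smul_left, huu, mul_one]
    simp only [map_add, map_smul, inner_add_left, inner_add_right, real_inner_smul_left,
      real_inner_smul_right, hus, hHuu]
    ring
  have hN_le : N (s + t • u) ≤ N s + t := by
    have h := hN.add_le s (t • u)
    rw [hN.smul, abs_of_nonneg ht] at h
    linarith [mul_le_mul_of_nonneg_left huN ht]
  have hcube : σ * N (s + t • u) ^ 3 ≤ σ * (N s + t) ^ 3 :=
    mul_le_mul_of_nonneg_left (pow_le_pow_left₀ (hN.nonneg _) hN_le 3) hσ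
  simp only [qm, hquad, inner_add_left, inner_add_right, real_inner_smul_right]
  linarith

/-- decrease along negative curvature: if `u` is a unit eigenvector
for `λ_min[H]` with `N(u) ≤ 1`, `⟪g+Hs,u⟫ ≤ 0` and `λ_min[H] + σN(s) < 0`, then for
some `α > 0`, `m(s) − m(s + αN(s)u) ≥ (3(λ_min+σN(s))/(4σ²))[ψ(s)σ²N(s)² −
(3/4)(λ_min+σN(s))²]`. -/
theorem stmt10 {n : ℕ} (hn : 1 ≤ n) (N : E n → ℝ) (hN : IsNorm n N)
    (f0 : ℝ) (g : E n) (H : E n →L[ℝ] E n)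
    (hH : ∀ x y : E n, ⟪H x, y⟫ = ⟪x, H y⟫)
    (σ : ℝ) (hσ : 0 < σ) (s : E n) (hs : s ≠ 0)
    (u : E n) (hu : H u = lamMin n H • u) (hu2 : ‖u‖ = 1) (huN : N u ≤ 1)
    (hsign : ⟪g + H s, u⟫ ≤ 0)
    (hneg : lamMin n H + σ * N s < 0) :
    ∃ α : ℝ, 0 < α ∧
      qm n N f0 g H σ s - qm n N f0 g H σ (s + (α * N s) • u) ≥
        3 * (lamMin n H + σ * N s) / (4 * σ ^ 2) *
          (max 0 (1 + 2 * ⟪g + H s, u⟫ / (σ * N s ^ 2)) * σ ^ 2 * N s ^ 2 -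
            3 / 4 * (lamMin n H + σ * N s) ^ 2) := by
  have hr : 0 < N s := (hN.nonneg s).lt_of_ne fun h => hs (hN.eq_zero s h.symm)
  set μ := lamMin n H + σ * N s with hμ
  set c := ⟪g + H s, u⟫
  set ψ := max 0 (1 + 2 * c / (σ * N s ^ 2))
  have ht : 0 < -3 * μ / (2 * σ) := div_pos (by linarith) (by linarith)
  refine ⟨-3 * μ / (2 * σ) / N s, div_pos ht hr, ?_⟩
  rw [div_mul_cancel₀ _ hr.ne']
  refine le_trans ?_ (qm_sub_qm_add_smul_ge hN f0 g hH hσ.le s hu hu2 huN ht.le)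
  rw [← hμ]
  have hψ : c + σ * N s ^ 2 / 2 ≤ ψ * (σ * N s ^ 2) / 2 := by
    have h := mul_le_mul_of_nonneg_right (le_max_right 0 (1 + 2 * c / (σ * N s ^ 2)))
      (by positivity : 0 ≤ σ * N s ^ 2)
    rw [add_mul, div_mul_cancel₀ _ (by positivity)] at h
    linarith
  calc 3 * μ / (4 * σ ^ 2) * (ψ * σ ^ 2 * N s ^ 2 - 3 / 4 * μ ^ 2)
      = -(-3 * μ / (2 * σ) * (ψ * (σ * N s ^ 2) / 2)) - (-3 * μ / (2 * σ)) ^ 2 * μ / 2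
          - σ * (-3 * μ / (2 * σ)) ^ 3 / 6 := by
        field_simp
        ring
    _ ≤ _ := by
        gcongr
end
end

section
/- Consider any AR2GN run for a function f satisfying AS.1 (with constants L_{r,2} and L_{2,2}) and AS.2 (with lower bound f_low), let ε₁, ε₂ ∈ (0,1], and suppose that for every j ∈ {0, …, k+1} the termination test fails, i.e. ‖∇f(x_j)‖_{N,1} > ε₁ or λ_min[∇²f(x_j)] < −ε₂. Then the number of successful iterations among {0, …, k}, i.e. #{ j ≤ k : ρ_j ≥ η₁ }, is at most (6 κ_AR2GN/(η₁ σ_min)) · (f(x₀) − f_low) / min(ε₁^{3/2}, ε₂³), where σ_max := γ₃ · max( σ₀, L_{r,2}/(1 − η₂) ), κ_ω := 1 + 2/√3, and κ_AR2GN := max{ ((L_{r,2} + θ₁ σ_max)/2)^{3/2}, (L_{2,2} + θ₂ κ_ω σ_max)³ }. -/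
open scoped RealInnerProductSpace

noncomputable section

/-- The Hessian of `f` at `x`, as the Fréchet derivative of the gradient. -/
def hess (n : ℕ) (f : E n → ℝ) (x : E n) : E n →L[ℝ] E n :=
  fderiv ℝ (gradient f) x

/-- The second-order Taylor polynomial
`T_{f,2}(x,s) = f(x) + ⟪∇f(x),s⟫ + (1/2)⟪∇²f(x)s,s⟫`. -/
def tay2 (n : ℕ) (f : E n → ℝ) (x s : E n) : ℝ :=
  f x + ⟪gradient f x, s⟫ + (1 / 2) * ⟪hess n f x s, s⟫

/-- The regularized second-order model `m_k(s) = T_{f,2}(x,s) + (σ_k/6) N(s)³`. -/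
def model2 (n : ℕ) (N : E n → ℝ) (f : E n → ℝ) (σk : ℝ) (x s : E n) : ℝ :=
  tay2 n f x s + σk / 6 * N s ^ 3

/-- The ratio `ρ = (f(x) − f(x+s))/(T_{f,2}(x,0) − T_{f,2}(x,s))`. -/
def rho2 (n : ℕ) (f : E n → ℝ) (x s : E n) : ℝ :=
  (f x - f (x + s)) / (tay2 n f x 0 - tay2 n f x s)

/-- The constant `κ_ω = 1 + 2/√3`. -/
def kappaOmega : ℝ := 1 + 2 / Real.sqrt 3

/-- An AR2GN run for `f` with starting point `x0`, initial regularization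
parameter `σ0` and parameters `σmin, η1, η2, γ1, γ2, γ3, θ1, θ2`. -/
structure AR2Run (n : ℕ) (N : E n → ℝ) (f : E n → ℝ) (x0 : E n)
    (σmin σ0 η1 η2 γ1 γ2 γ3 θ1 θ2 : ℝ) where
  x : ℕ → E n
  s : ℕ → E n
  σ : ℕ → ℝ
  x_init : x 0 = x0
  σ_init : σ 0 = σ0
  s_ne : ∀ k, s k ≠ 0
  σ_pos : ∀ k, 0 < σ k
  /-- (i) sufficient model decrease `m_k(s_k) ≤ m_k(0)` -/
  descent : ∀ k, model2 n N f (σ k) (x k) (s k) ≤ model2 n N f (σ k) (x k) 0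
  /-- (ii) `‖∇_s T_{f,2}(x_k,s_k)‖_{N,1} ≤ θ1 (σ_k/2) N(s_k)²` -/
  term_model : ∀ k,
    dualNorm n N (gradient f (x k) + hess n f (x k) (s k)) ≤
      θ1 * (σ k / 2) * N (s k) ^ 2
  /-- (ii') `λ_min[∇²f(x_k)] + θ2 κ_ω σ_k N(s_k) ≥ 0` -/
  curvature : ∀ k, 0 ≤ lamMin n (hess n f (x k)) + θ2 * kappaOmega * σ k * N (s k)
  /-- (iii) successful step -/
  succ_step : ∀ k, η1 ≤ rho2 n f (x k) (s k) → x (k + 1) = x k + s k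
  /-- (iii) unsuccessful step -/
  fail_step : ∀ k, rho2 n f (x k) (s k) < η1 → x (k + 1) = x k
  /-- (iv) very successful update -/
  σ_vsucc : ∀ k, η2 ≤ rho2 n f (x k) (s k) →
    max σmin (γ1 * σ k) ≤ σ (k + 1) ∧ σ (k + 1) ≤ σ k
  /-- (iv) successful update -/
  σ_succ : ∀ k, η1 ≤ rho2 n f (x k) (s k) → rho2 n f (x k) (s k) < η2 →
    σ k ≤ σ (k + 1) ∧ σ (k + 1) ≤ γ2 * σ k
  /-- (iv) unsuccessful update -/
  σ_fail : ∀ k, rho2 n f (x k) (s k) < η1 →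
    γ2 * σ k ≤ σ (k + 1) ∧ σ (k + 1) ≤ γ3 * σ k

open Set

namespace IsNorm

variable {n : ℕ} {N : E n → ℝ}

theorem map_zero (hN : IsNorm n N) : N 0 = 0 := by
  simpa using hN.smul 0 0

theorem nonneg_s13 (hN : IsNorm n N) (x : E n) : 0 ≤ N x := by
  have h := hN.add_le x ((-1 : ℝ) • x)
  rw [hN.smul] at h
  simp [hN.map_zero] at h
  linarith

theorem pos (hN : IsNorm n N) {x : E n} (hx : x ≠ 0) : 0 < N x :=
  lt_of_le_of_ne (hN.nonneg_s13 x) fun h => hx (hN.eq_zero x h.symm)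

theorem continuous (hN : IsNorm n N) : Continuous N := by
  have hc : ConvexOn ℝ univ N := by
    refine ⟨convex_univ, fun x _ y _ a b ha hb _ => ?_⟩
    have := hN.add_le (a • x) (b • y)
    rw [hN.smul, hN.smul, abs_of_nonneg ha, abs_of_nonneg hb] at this
    simpa using this
  exact continuousOn_univ.mp (hc.continuousOn isOpen_univ)

theorem exists_norm_le (hN : IsNorm n N) : ∃ C : ℝ, 0 ≤ C ∧ ∀ x, ‖x‖ ≤ C * N x := by
  rcases (Metric.sphere (0 : E n) 1).eq_empty_or_nonempty with h | h
  · refine ⟨0, le_rfl, fun x => ?_⟩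
    by_cases hx : x = 0
    · simp [hx]
    · exfalso
      have : ‖x‖⁻¹ • x ∈ Metric.sphere (0 : E n) 1 := by
        simp [norm_smul, inv_mul_cancel₀ (norm_ne_zero_iff.mpr hx)]
      simp [h] at this
  · obtain ⟨y, hy, hmin⟩ := (isCompact_sphere (0 : E n) 1).exists_isMinOn h hN.continuous.continuousOn
    have hy1 : ‖y‖ = 1 := by simpa using hy
    have hNy : 0 < N y := hN.pos (by rintro rfl; simp at hy1)
    refine ⟨(N y)⁻¹, (inv_pos.mpr hNy).le, fun x => ?_⟩
    by_cases hx : x = 0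
    · simp [hx, hN.map_zero]
    · have hx' : 0 < ‖x‖ := norm_pos_iff.mpr hx
      have hm : ‖x‖⁻¹ • x ∈ Metric.sphere (0 : E n) 1 := by
        simp [norm_smul, inv_mul_cancel₀ hx'.ne']
      have := hmin hm
      simp only [mem_ofPred_eq, hN.smul, abs_inv, abs_norm] at this
      rw [inv_mul_eq_div, le_div_iff₀ hx'] at this
      rw [inv_mul_eq_div, le_div_iff₀ hNy]
      linarith

theorem exists_eq_one (hN : IsNorm n N) (hn : 1 ≤ n) : ∃ v, N v = 1 := by
  have : Nonempty (Fin n) := ⟨⟨0, hn⟩⟩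
  obtain ⟨v, hv⟩ := exists_ne (0 : E n)
  refine ⟨(N v)⁻¹ • v, ?_⟩
  rw [hN.smul, abs_of_pos (inv_pos.mpr (hN.pos hv)), inv_mul_cancel₀ (hN.pos hv).ne']

theorem inner_le_dualNorm (hN : IsNorm n N) (g : E n) {v : E n} (hv : N v = 1) :
    ⟪g, v⟫ ≤ dualNorm n N g := by
  obtain ⟨C, -, hC⟩ := hN.exists_norm_le
  refine le_csSup ⟨‖g‖ * C, ?_⟩ ⟨v, hv, rfl⟩
  rintro _ ⟨s, hs, rfl⟩
  refine (real_inner_le_norm g s).trans ?_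
  have := hC s
  rw [hs, mul_one] at this
  gcongr

theorem abs_inner_le_matNormN (hN : IsNorm n N) (A : E n →L[ℝ] E n) (v : E n) :
    |⟪A v, v⟫| ≤ matNormN n N A * N v ^ 2 := by
  by_cases hv : v = 0
  · simp [hv, hN.map_zero]
  obtain ⟨C, hC0, hC⟩ := hN.exists_norm_le
  have hb : BddAbove {t : ℝ | ∃ v : E n, N v = 1 ∧ t = |⟪A v, v⟫|} := by
    refine ⟨‖A‖ * C * C, ?_⟩
    rintro _ ⟨s, hs, rfl⟩
    have := hC s
    rw [hs, mul_one] at this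
    calc |⟪A s, s⟫| ≤ ‖A s‖ * ‖s‖ := abs_real_inner_le_norm _ _
      _ ≤ ‖A‖ * ‖s‖ * ‖s‖ := by gcongr; exact A.le_opNorm s
      _ ≤ ‖A‖ * C * C := by gcongr
  have hNv := hN.pos hv
  have h1 : N ((N v)⁻¹ • v) = 1 := by
    rw [hN.smul, abs_of_pos (inv_pos.mpr hNv), inv_mul_cancel₀ hNv.ne']
  have h2 := le_csSup hb ⟨_, h1, rfl⟩
  rw [map_smul, inner_smul_left, inner_smul_right, abs_mul, abs_mul] at h2
  simp only [conj_trivial, abs_inv, abs_of_pos hNv] at h2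
  have h3 : (N v)⁻¹ * ((N v)⁻¹ * |⟪A v, v⟫|) = |⟪A v, v⟫| / N v ^ 2 := by
    field_simp
  rw [h3, div_le_iff₀ (by positivity)] at h2
  exact h2

end IsNorm

theorem lamMin_le_add {n : ℕ} (hn : 1 ≤ n) (A B : E n →L[ℝ] E n) :
    lamMin n A ≤ lamMin n B + ‖B - A‖ := by
  have hb : BddBelow {t : ℝ | ∃ v : E n, ‖v‖ = 1 ∧ t = ⟪A v, v⟫} := by
    refine ⟨-‖A‖, ?_⟩
    rintro _ ⟨v, hv, rfl⟩
    have h1 := abs_real_inner_le_norm (A v) v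
    have h2 := A.le_opNorm v
    rw [hv, mul_one] at h1 h2
    exact (abs_le.mp (h1.trans h2)).1
  rw [← sub_le_iff_le_add]
  have : Nonempty (Fin n) := ⟨⟨0, hn⟩⟩
  obtain ⟨u, hu⟩ := exists_norm_eq (E n) zero_le_one
  refine le_csInf ⟨_, u, hu, rfl⟩ ?_
  rintro _ ⟨v, hv, rfl⟩
  have h1 := abs_real_inner_le_norm ((B - A) v) v
  have h2 := (B - A).le_opNorm v
  rw [hv, mul_one] at h1 h2
  have h3 := (abs_le.mp (h1.trans h2)).1
  have h4 : lamMin n A ≤ ⟪A v, v⟫ := csInf_le hb ⟨v, hv, rfl⟩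
  rw [sub_apply, inner_sub_left] at h3
  linarith

/-- A real function on `[0, 1]` starting at `0` is bounded by any function starting at `0` with
larger derivative. -/
theorem le_of_hasDerivAt_le {φ φ' B B' : ℝ → ℝ} (hφ : ∀ t, HasDerivAt φ (φ' t) t)
    (hB : ∀ t, HasDerivAt B (B' t) t) (h0 : φ 0 ≤ B 0)
    (h : ∀ t ∈ Icc (0 : ℝ) 1, φ' t ≤ B' t) :
    ∀ t ∈ Icc (0 : ℝ) 1, φ t ≤ B t := fun _ ht =>
  image_le_of_deriv_right_le_deriv_boundary
    (fun t _ => (hφ t).continuousAt.continuousWithinAt) (fun t _ => (hφ t).hasDerivWithinAt) h0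
    (fun t _ => (hB t).continuousAt.continuousWithinAt) (fun t _ => (hB t).hasDerivWithinAt)
    (fun t ht => h t (Ico_subset_Icc_self ht)) ht

section Calculus

variable {n : ℕ} {f : E n → ℝ}

theorem hasFDerivAt_of_contDiff_two (hf : ContDiff ℝ 2 f) (x : E n) :
    HasFDerivAt f (innerSL ℝ (gradient f x)) x := by
  have h := (hf.differentiable (by norm_num) x).hasGradientAt.hasFDerivAt
  exact h

theorem gradient_eq_toDual_symm_comp :
    gradient f = (InnerProductSpace.toDual ℝ (E n)).symm ∘ fderiv ℝ f := rfl

theorem hasFDerivAt_gradient (hf : ContDiff ℝ 2 f) (x : E n) :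
    HasFDerivAt (gradient f) (hess n f x) x := by
  refine DifferentiableAt.hasFDerivAt ?_
  rw [gradient_eq_toDual_symm_comp]
  have h : DifferentiableAt ℝ (fderiv ℝ f) x :=
    (hf.fderiv_right (m := 1) (by norm_num)).differentiable (by norm_num) x
  exact ((InnerProductSpace.toDual ℝ (E n)).symm.toContinuousLinearEquiv.differentiableAt).comp x h

theorem hasDerivAt_line (x s : E n) (t : ℝ) : HasDerivAt (fun t : ℝ => x + t • s) s t := by
  simpa using ((hasDerivAt_id t).smul_const s).const_add x

theorem hasDerivAt_comp_line (hf : ContDiff ℝ 2 f) (x s : E n) (t : ℝ) :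
    HasDerivAt (fun t : ℝ => f (x + t • s)) ⟪gradient f (x + t • s), s⟫ t := by
  have h := (hasFDerivAt_of_contDiff_two hf (x + t • s)).comp_hasDerivAt t (hasDerivAt_line x s t)
  exact h

theorem hasDerivAt_inner_gradient_line (hf : ContDiff ℝ 2 f) (x s v : E n) (t : ℝ) :
    HasDerivAt (fun t : ℝ => ⟪gradient f (x + t • s), v⟫) ⟪hess n f (x + t • s) s, v⟫ t := by
  have h := (hasFDerivAt_gradient hf (x + t • s)).comp_hasDerivAt t (hasDerivAt_line x s t)
  simpa using h.inner ℝ (hasDerivAt_const t v)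

theorem inner_hess (hf : ContDiff ℝ 2 f) (u v x : E n) :
    ⟪hess n f x u, v⟫ = fderiv ℝ (fderiv ℝ f) x u v := by
  have h : DifferentiableAt ℝ (fderiv ℝ f) x :=
    (hf.fderiv_right (m := 1) (by norm_num)).differentiable (by norm_num) x
  have h1 : HasFDerivAt (fun y => fderiv ℝ f y v)
      ((ContinuousLinearMap.apply ℝ ℝ v).comp (fderiv ℝ (fderiv ℝ f) x)) x :=
    (ContinuousLinearMap.apply ℝ ℝ v).hasFDerivAt.comp x h.hasFDerivAt
  have h2 : HasFDerivAt (fun y => fderiv ℝ f y v)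
      ((innerSL ℝ v).comp (hess n f x)) x := by
    have h3 : (fun y => fderiv ℝ f y v) = fun y => innerSL ℝ v (gradient f y) :=
      funext fun y => by simp
    rw [h3]
    exact (innerSL ℝ v).hasFDerivAt.comp x (hasFDerivAt_gradient hf x)
  have h4 := congrArg (fun A : E n →L[ℝ] ℝ => A u) (h2.unique h1)
  rw [real_inner_comm]
  exact h4

theorem inner_hess_comm (hf : ContDiff ℝ 2 f) (u v x : E n) :
    ⟪hess n f x u, v⟫ = ⟪hess n f x v, u⟫ := by
  rw [inner_hess hf, inner_hess hf]
  exact (hf.contDiffAt.isSymmSndFDerivAt (by simp)).eq u v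

variable {N : E n → ℝ} {L : ℝ}

theorem inner_hess_sub_le (hN : IsNorm n N)
    (hL : ∀ x y : E n, matNormN n N (hess n f x - hess n f y) ≤ L * N (x - y)) (x y v : E n) :
    ⟪hess n f x v, v⟫ - ⟪hess n f y v, v⟫ ≤ L * N (x - y) * N v ^ 2 := by
  have h := (le_abs_self _).trans (hN.abs_inner_le_matNormN (hess n f x - hess n f y) v)
  rw [sub_apply, inner_sub_left] at h
  exact h.trans (mul_le_mul_of_nonneg_right (hL x y) (sq_nonneg _))

theorem le_tay2_add (hN : IsNorm n N) (hf : ContDiff ℝ 2 f)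
    (hL : ∀ x y : E n, matNormN n N (hess n f x - hess n f y) ≤ L * N (x - y)) (x s : E n) :
    f (x + s) ≤ tay2 n f x s + L / 6 * N s ^ 3 := by
  have h1 : ∀ t ∈ Icc (0 : ℝ) 1, ⟪gradient f (x + t • s), s⟫ ≤
      ⟪gradient f x, s⟫ + t * ⟪hess n f x s, s⟫ + t ^ 2 * (L * N s ^ 3 / 2) := by
    refine le_of_hasDerivAt_le (hasDerivAt_inner_gradient_line hf x s s)
      (B' := fun t => ⟪hess n f x s, s⟫ + 2 * t * (L * N s ^ 3 / 2)) (fun t => ?_) (by simp)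
      fun t ht => ?_
    · simpa using (((hasDerivAt_id t).mul_const _).const_add _).fun_add
        ((hasDerivAt_pow 2 t).mul_const (L * N s ^ 3 / 2))
    · have := inner_hess_sub_le hN hL (x + t • s) x s
      rw [add_sub_cancel_left, hN.smul, abs_of_nonneg ht.1] at this
      linarith
  have h2 := le_of_hasDerivAt_le (hasDerivAt_comp_line hf x s)
    (B := fun t => f x + t * ⟪gradient f x, s⟫ + t ^ 2 * (⟪hess n f x s, s⟫ / 2) +
      t ^ 3 * (L * N s ^ 3 / 6))
    (B' := fun t => ⟪gradient f x, s⟫ + 2 * t * (⟪hess n f x s, s⟫ / 2) +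
      3 * t ^ 2 * (L * N s ^ 3 / 6)) (fun t => ?_) (by simp) (fun t ht => ?_) 1 (by simp)
  · simp only [one_smul] at h2
    unfold tay2
    linarith
  · simpa using ((((hasDerivAt_id t).mul_const _).const_add _).fun_add
      ((hasDerivAt_pow 2 t).mul_const (⟪hess n f x s, s⟫ / 2))).fun_add
        ((hasDerivAt_pow 3 t).mul_const (L * N s ^ 3 / 6))
  · linarith [h1 t ht]

/-- Only the diagonal of the Hessian difference is controlled by `matNormN`, so the gradient
remainder is bounded by moving the base point in the direction `v`. -/
theorem inner_gradient_le (hN : IsNorm n N) (hf : ContDiff ℝ 2 f)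
    (hL : ∀ x y : E n, matNormN n N (hess n f x - hess n f y) ≤ L * N (x - y)) (x s v : E n) :
    ⟪gradient f (x + s), v⟫ ≤
      ⟪gradient f x + hess n f x s, v⟫ + L / 2 * N s ^ 2 * N v := by
  set g : ℝ → ℝ := fun e =>
    f (x + s + e • v) - f (x + e • v) - ⟪gradient f (x + e • v), s⟫ with hg
  have hg' : HasDerivAt g
      (⟪gradient f (x + s), v⟫ - ⟪gradient f x, v⟫ - ⟪hess n f x v, s⟫) 0 := by
    simpa [hg] using ((hasDerivAt_comp_line hf (x + s) v 0).fun_sub (hasDerivAt_comp_line hf x v 0)).fun_sub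
      (hasDerivAt_inner_gradient_line hf x v s 0)
  have hle : ∀ e > 0, g e - g 0 ≤ e * (L / 2 * N s ^ 2 * N v) := by
    intro e he
    set y := x + e • v with hy
    have h1 : ∀ t ∈ Icc (0 : ℝ) 1,
        ⟪gradient f (y + t • s), s⟫ - ⟪gradient f (x + t • s), s⟫ ≤
          ⟪gradient f y, s⟫ - ⟪gradient f x, s⟫ + t * (L * (e * N v) * N s ^ 2) := by
      refine le_of_hasDerivAt_le (fun t => (hasDerivAt_inner_gradient_line hf y s s t).sub
        (hasDerivAt_inner_gradient_line hf x s s t))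
        (B' := fun _ => L * (e * N v) * N s ^ 2) (fun t => ?_) (by simp) fun t ht => ?_
      · simpa using ((hasDerivAt_id t).mul_const (L * (e * N v) * N s ^ 2)).const_add
          (⟪gradient f y, s⟫ - ⟪gradient f x, s⟫)
      · have := inner_hess_sub_le hN hL (y + t • s) (x + t • s) s
        rwa [add_sub_add_right_eq_sub, hy, add_sub_cancel_left, hN.smul, abs_of_pos he] at this
    have h2 := le_of_hasDerivAt_le (fun t => (hasDerivAt_comp_line hf y s t).sub
        (hasDerivAt_comp_line hf x s t))
      (B := fun t => (f y - f x) + t * (⟪gradient f y, s⟫ - ⟪gradient f x, s⟫) +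
        t ^ 2 * (L * (e * N v) * N s ^ 2 / 2))
      (B' := fun t => (⟪gradient f y, s⟫ - ⟪gradient f x, s⟫) +
        2 * t * (L * (e * N v) * N s ^ 2 / 2)) (fun t => ?_) (by simp) (fun t ht => ?_) 1 (by simp)
    · have h3 : x + s + e • v = y + s := by rw [hy]; abel
      simp only [one_smul, Pi.sub_apply] at h2
      simp only [hg, h3, zero_smul, add_zero, ← hy]
      linarith
    · simpa using (((hasDerivAt_id t).mul_const _).const_add _).fun_add
        ((hasDerivAt_pow 2 t).mul_const (L * (e * N v) * N s ^ 2 / 2))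
    · linarith [h1 t ht]
  have hlim := hg'.hasDerivWithinAt (s := Ioi 0)
  rw [hasDerivWithinAt_iff_tendsto_slope' (by simp)] at hlim
  have := le_of_tendsto hlim (b := L / 2 * N s ^ 2 * N v) (by
    filter_upwards [self_mem_nhdsWithin] with e he
    have he' : (0 : ℝ) < e := he
    rw [slope_def_field, sub_zero, div_le_iff₀ he']
    linarith [hle e he'])
  rw [inner_add_left, inner_hess_comm hf]
  linarith

theorem dualNorm_gradient_add_le (hn : 1 ≤ n) (hN : IsNorm n N) (hf : ContDiff ℝ 2 f)
    (hL : ∀ x y : E n, matNormN n N (hess n f x - hess n f y) ≤ L * N (x - y)) (x s : E n) :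
    dualNorm n N (gradient f (x + s)) ≤
      dualNorm n N (gradient f x + hess n f x s) + L / 2 * N s ^ 2 := by
  obtain ⟨u, hu⟩ := hN.exists_eq_one hn
  refine csSup_le ⟨_, u, hu, rfl⟩ ?_
  rintro _ ⟨v, hv, rfl⟩
  have h1 := inner_gradient_le hN hf hL x s v
  have h2 := hN.inner_le_dualNorm (gradient f x + hess n f x s) hv
  rw [hv] at h1
  linarith

end Calculus

theorem kappaOmega_pos : 0 < kappaOmega := by
  unfold kappaOmega
  positivity

namespace AR2Run

variable {n : ℕ} {N : E n → ℝ} {f : E n → ℝ} {x0 : E n}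
  {σmin σ0 η1 η2 γ1 γ2 γ3 θ1 θ2 L : ℝ}

theorem decrease (hN : IsNorm n N) (run : AR2Run n N f x0 σmin σ0 η1 η2 γ1 γ2 γ3 θ1 θ2) (k : ℕ) :
    run.σ k / 6 * N (run.s k) ^ 3 ≤
      tay2 n f (run.x k) 0 - tay2 n f (run.x k) (run.s k) := by
  have h := run.descent k
  simp only [model2, hN.map_zero] at h
  linarith

theorem decrease_pos (hN : IsNorm n N) (run : AR2Run n N f x0 σmin σ0 η1 η2 γ1 γ2 γ3 θ1 θ2)
    (k : ℕ) : 0 < tay2 n f (run.x k) 0 - tay2 n f (run.x k) (run.s k) := by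
  have h1 := hN.pos (run.s_ne k)
  have h2 := run.σ_pos k
  exact lt_of_lt_of_le (by positivity) (run.decrease hN k)

theorem sigma_lt_of_rho2_lt (hN : IsNorm n N) (hf : ContDiff ℝ 2 f)
    (hL : ∀ x y : E n, matNormN n N (hess n f x - hess n f y) ≤ L * N (x - y)) (hη2 : η2 < 1)
    (run : AR2Run n N f x0 σmin σ0 η1 η2 γ1 γ2 γ3 θ1 θ2) {k : ℕ}
    (hk : rho2 n f (run.x k) (run.s k) < η2) : run.σ k < L / (1 - η2) := by
  have h1 := le_tay2_add hN hf hL (run.x k) (run.s k)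
  have h2 := run.decrease hN k
  rw [rho2, div_lt_iff₀ (run.decrease_pos hN k)] at hk
  have h0 : tay2 n f (run.x k) 0 = f (run.x k) := by simp [tay2]
  have h3 := hN.pos (run.s_ne k)
  have hη : 0 < 1 - η2 := by linarith
  rw [lt_div_iff₀ hη]
  have h4 := mul_le_mul_of_nonneg_left h2 hη.le
  have h5 : run.σ k * (1 - η2) * (N (run.s k) ^ 3 / 6) < L * (N (run.s k) ^ 3 / 6) := by
    rw [h0] at hk h4
    linarith
  exact lt_of_mul_lt_mul_right h5 (by positivity)

theorem le_sigma (hσ0 : σmin ≤ σ0) (hγ2 : 1 < γ2)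
    (run : AR2Run n N f x0 σmin σ0 η1 η2 γ1 γ2 γ3 θ1 θ2) (k : ℕ) : σmin ≤ run.σ k := by
  induction k with
  | zero => rwa [run.σ_init]
  | succ k ih =>
    rcases le_or_gt η2 (rho2 n f (run.x k) (run.s k)) with h | h
    · exact (le_max_left _ _).trans (run.σ_vsucc k h).1
    rcases le_or_gt η1 (rho2 n f (run.x k) (run.s k)) with h' | h'
    · exact ih.trans (run.σ_succ k h' h).1
    · nlinarith [(run.σ_fail k h').1, run.σ_pos k]

theorem sigma_le (hN : IsNorm n N) (hf : ContDiff ℝ 2 f)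
    (hL : ∀ x y : E n, matNormN n N (hess n f x - hess n f y) ≤ L * N (x - y)) (hη2 : η2 < 1)
    (hγ2 : 1 < γ2) (hγ23 : γ2 < γ3)
    (run : AR2Run n N f x0 σmin σ0 η1 η2 γ1 γ2 γ3 θ1 θ2) (k : ℕ) :
    run.σ k ≤ γ3 * max σ0 (L / (1 - η2)) := by
  have hγ3 : 0 < γ3 := by linarith
  induction k with
  | zero =>
    have h := run.σ_pos 0
    rw [run.σ_init] at h ⊢
    have := le_max_left σ0 (L / (1 - η2))
    nlinarith
  | succ k ih =>
    rcases le_or_gt η2 (rho2 n f (run.x k) (run.s k)) with h | h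
    · exact (run.σ_vsucc k h).2.trans ih
    have h1 : γ3 * run.σ k ≤ γ3 * max σ0 (L / (1 - η2)) := mul_le_mul_of_nonneg_left
      ((run.sigma_lt_of_rho2_lt hN hf hL hη2 h).le.trans (le_max_right _ _)) hγ3.le
    refine le_trans ?_ h1
    rcases le_or_gt η1 (rho2 n f (run.x k) (run.s k)) with h' | h'
    · exact (run.σ_succ k h' h).2.trans (mul_le_mul_of_nonneg_right hγ23.le (run.σ_pos k).le)
    · exact (run.σ_fail k h').2

/-- If every successful iteration `j ≤ k` has a step with `c ≤ N (s j) ^ 3`, the decrease of `f`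
is at least proportional to the number of successful iterations. -/
theorem card_mul_le (hN : IsNorm n N) (hσmin : 0 < σmin) (hσ0 : σmin ≤ σ0) (hγ2 : 1 < γ2)
    (hη1 : 0 < η1) (run : AR2Run n N f x0 σmin σ0 η1 η2 γ1 γ2 γ3 θ1 θ2) {c : ℝ} (k : ℕ)
    (hc : ∀ j < k, η1 ≤ rho2 n f (run.x j) (run.s j) → c ≤ N (run.s j) ^ 3) :
    (((Finset.range k).filter
      (fun j => η1 ≤ rho2 n f (run.x j) (run.s j))).card : ℝ) * (η1 * (σmin / 6 * c)) ≤
      f x0 - f (run.x k) := by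
  induction k with
  | zero => simp [run.x_init]
  | succ k ih =>
    have ih := ih fun j hj => hc j (hj.trans k.lt_succ_self)
    rw [Finset.range_add_one, Finset.filter_insert]
    split_ifs with h
    · rw [Finset.card_insert_of_notMem (by simp), run.succ_step k h]
      have h1 := h
      rw [rho2, le_div_iff₀ (run.decrease_pos hN k)] at h1
      have h2 : σmin / 6 * c ≤ run.σ k / 6 * N (run.s k) ^ 3 :=
        (mul_le_mul_of_nonneg_left (hc k k.lt_succ_self h) (by positivity)).trans
          (mul_le_mul_of_nonneg_right (by linarith [run.le_sigma hσ0 hγ2 k])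
            (pow_nonneg (hN.nonneg_s13 _) 3))
      have h3 := mul_le_mul_of_nonneg_left (h2.trans (run.decrease hN k)) hη1.le
      push_cast
      linarith
    · rwa [run.fail_step k (not_le.mp h)]

end AR2Run

/-- evaluation complexity of AR2GN: under AS.1 and AS.2, if the
termination test fails up to iteration `k+1`, the number of successful iterations
among `{0,…,k}` is at most
`(6 κ_AR2GN/(η1 σmin)) (f(x0) − f_low)/min(ε1^{3/2}, ε2³)`. -/
theorem stmt13 {n : ℕ} (hn : 1 ≤ n) (N : E n → ℝ) (hN : IsNorm n N)
    (f : E n → ℝ) (hf : ContDiff ℝ 2 f) (Lr2 L22 : ℝ) (hLr2 : 0 ≤ Lr2) (hL22 : 0 ≤ L22)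
    (hLipr : ∀ x y : E n, matNormN n N (hess n f x - hess n f y) ≤ Lr2 * N (x - y))
    (hLip2 : ∀ x y : E n, ‖hess n f x - hess n f y‖ ≤ L22 * N (x - y))
    (flow : ℝ) (hflow : ∀ x, flow ≤ f x)
    (x0 : E n) (σmin σ0 η1 η2 γ1 γ2 γ3 θ1 θ2 : ℝ)
    (hσmin : 0 < σmin) (hσ0 : σmin ≤ σ0)
    (hη1 : 0 < η1) (hη12 : η1 ≤ η2) (hη2 : η2 < 1)
    (hγ1 : 0 < γ1) (hγ11 : γ1 < 1) (hγ2 : 1 < γ2) (hγ23 : γ2 < γ3)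
    (hθ1 : 1 < θ1) (hθ2 : 1 < θ2)
    (run : AR2Run n N f x0 σmin σ0 η1 η2 γ1 γ2 γ3 θ1 θ2)
    (ε1 ε2 : ℝ) (hε1 : 0 < ε1) (hε1' : ε1 ≤ 1) (hε2 : 0 < ε2) (hε2' : ε2 ≤ 1)
    (k : ℕ)
    (hterm : ∀ j ≤ k + 1,
      ε1 < dualNorm n N (gradient f (run.x j)) ∨
        lamMin n (hess n f (run.x j)) < -ε2) :
    (((Finset.range (k + 1)).filter
        (fun j => η1 ≤ rho2 n f (run.x j) (run.s j))).card : ℝ) ≤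
      6 * (max (((Lr2 + θ1 * (γ3 * max σ0 (Lr2 / (1 - η2)))) / 2) ^ ((3 : ℝ) / 2))
            ((L22 + θ2 * kappaOmega * (γ3 * max σ0 (Lr2 / (1 - η2)))) ^ 3)) /
          (η1 * σmin) *
        (f x0 - flow) / min (ε1 ^ ((3 : ℝ) / 2)) (ε2 ^ 3) := by
  set σmax := γ3 * max σ0 (Lr2 / (1 - η2)) with hσmax
  set A := (Lr2 + θ1 * σmax) / 2 with hA
  set B := L22 + θ2 * kappaOmega * σmax with hB
  set κ := max (A ^ ((3 : ℝ) / 2)) (B ^ 3) with hκ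
  set m := min (ε1 ^ ((3 : ℝ) / 2)) (ε2 ^ 3) with hm
  have hσle := run.sigma_le hN hf hLipr hη2 hγ2 hγ23
  have hσmax0 : 0 < σmax := (run.σ_pos 0).trans_le (hσle 0)
  have hκω := kappaOmega_pos
  have hA0 : 0 < A := by positivity
  have hB0 : 0 < B := by positivity
  have hκ0 : 0 < κ := lt_max_of_lt_right (by positivity)
  have hm0 : 0 < m := lt_min (by positivity) (by positivity)
  have hstep : ∀ j < k + 1, η1 ≤ rho2 n f (run.x j) (run.s j) → m / κ ≤ N (run.s j) ^ 3 := by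
    intro j hj hs
    have hN0 := hN.nonneg_s13 (run.s j)
    rw [div_le_iff₀ hκ0]
    have ht := hterm (j + 1) (by omega)
    rw [run.succ_step j hs] at ht
    rcases ht with ht | ht
    · have h1 := dualNorm_gradient_add_le hn hN hf hLipr (run.x j) (run.s j)
      have h2 : θ1 * (run.σ j / 2) * N (run.s j) ^ 2 ≤ θ1 * (σmax / 2) * N (run.s j) ^ 2 := by
        gcongr
        exact hσle j
      have h3 : ε1 ≤ N (run.s j) ^ 2 * A := by
        rw [hA]
        linarith [run.term_model j]
      have h4 := Real.rpow_le_rpow hε1.le h3 (show (0 : ℝ) ≤ 3 / 2 by norm_num)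
      rw [Real.mul_rpow (by positivity) hA0.le, ← Real.rpow_natCast, ← Real.rpow_mul hN0,
        show ((2 : ℕ) : ℝ) * (3 / 2) = ((3 : ℕ) : ℝ) by norm_num, Real.rpow_natCast] at h4
      exact (min_le_left _ _).trans (h4.trans (by gcongr; exact le_max_left _ _))
    · have h1 := lamMin_le_add hn (hess n f (run.x j)) (hess n f (run.x j + run.s j))
      have h2 := hLip2 (run.x j + run.s j) (run.x j)
      rw [add_sub_cancel_left] at h2
      have h3 : θ2 * kappaOmega * run.σ j * N (run.s j) ≤
          θ2 * kappaOmega * σmax * N (run.s j) := by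
        gcongr
        exact hσle j
      have h4 : ε2 ≤ N (run.s j) * B := by
        rw [hB]
        linarith [run.curvature j]
      have h5 := pow_le_pow_left₀ hε2.le h4 3
      rw [mul_pow] at h5
      exact (min_le_right _ _).trans (h5.trans (by gcongr; exact le_max_right _ _))
  have h := (run.card_mul_le hN hσmin hσ0 hγ2 hη1 (k + 1) hstep).trans
    (sub_le_sub_left (hflow _) _)
  rw [← le_div_iff₀ (by positivity)] at h
  refine h.trans_eq ?_
  field_simp
end
end
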